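/- arXiv:1306.1157 — 4 statements merged into one kernel-verified Lean document; each statement's English description precedes it below -/
import Mathlib

section
/- A perfect linear index coding solution of dimension n over some finite field exists for the index coding problem I^D(Z,R) constructed from a discrete polymatroid D if and only if the discrete polymatroid nD is representable over some finite field. -/
open scoped Classical

/-- Sum of the components of `u` indexed by the elements of `A`. -/
noncomputable def setSum {r : ℕ} (u : Fin r → ℕ) (A : Set (Fin r)) : ℕ :=
  ∑ i ∈ Finset.univ.filter (· ∈ A), u i

/-- A discrete polymatroid on the ground set `{1,…,r}` (modelled as `Fin r`). -/
structure DiscretePolymatroid (r : ℕ) where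
  carrier : Set (Fin r → ℕ)
  nonempty : carrier.Nonempty
  finite : carrier.Finite
  lower : ∀ u ∈ carrier, ∀ v : Fin r → ℕ, (∀ i, v i ≤ u i) → v ∈ carrier
  exchange : ∀ u ∈ carrier, ∀ v ∈ carrier, (∑ i, u i) < (∑ i, v i) →
    ∃ w ∈ carrier, (∀ i, u i ≤ w i) ∧ u ≠ w ∧ ∀ i, w i ≤ max (u i) (v i)

namespace DiscretePolymatroid

variable {r : ℕ} (D : DiscretePolymatroid r)

/-- The rank function of a discrete polymatroid. -/
noncomputable def rho (A : Set (Fin r)) : ℕ :=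
  D.finite.toFinset.sup fun u => setSum u A

/-- `ρ_max(D) = max_i ρ({i})`. -/
noncomputable def rhoMax : ℕ := Finset.univ.sup fun i : Fin r => D.rho {i}

/-- The rank of the discrete polymatroid (the common component sum of its basis vectors). -/
noncomputable def rank : ℕ := D.rho Set.univ

end DiscretePolymatroid

/-- The subspaces `V i` of `F^d` represent the rank function `ρ'` when
`dim (∑_{i ∈ X} V i) = ρ'(X)` for every `X`. -/
def RepFnOver (r : ℕ) (ρ' : Set (Fin r) → ℕ) (F : Type) [Field F] : Prop :=
  ∃ (d : ℕ) (V : Fin r → Submodule F (Fin d → F)),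
    ∀ X : Set (Fin r), Module.finrank F ↥(⨆ i ∈ X, V i) = ρ' X

/-- A discrete polymatroid is representable over `F` if its rank function is. -/
def DiscretePolymatroid.RepresentableOver {r : ℕ} (D : DiscretePolymatroid r)
    (F : Type) [Field F] : Prop :=
  RepFnOver r D.rho F


/-- An index coding problem with message index type `M`: a receiver `(x, H)` demands the
message `x` and has the set of messages `H` as side information. -/
structure IndexProblem (M : Type) where
  recv : Set (M × Set M)

/-- A linear index coding solution over `F` of length `c` and dimension `n`: each message is
a row vector of length `n` over `F`, the encoding map `f` is linear, and every receiver can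
recover its demanded message from its side information and `f(y)` by a linear decoding map. -/
def HasLinearIndexCode {M : Type} (P : IndexProblem M) (F : Type) [Field F]
    (n c : ℕ) : Prop :=
  ∃ f : ((M → Fin n → F) →ₗ[F] (Fin c → F)),
    ∀ p ∈ P.recv, ∃ ψ : ((↥p.2 → Fin n → F) × (Fin c → F)) →ₗ[F] (Fin n → F),
      ∀ y : M → Fin n → F, ψ (fun j => y j.1, f y) = y p.1

namespace DiscretePolymatroid

variable {r : ℕ} (D : DiscretePolymatroid r)

/-- A basis vector of a discrete polymatroid: a maximal element of the carrier. -/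
def IsBasisVec (b : Fin r → ℕ) : Prop :=
  b ∈ D.carrier ∧ ∀ u ∈ D.carrier, (∀ i, b i ≤ u i) → u = b

/-- An excluded vector of a discrete polymatroid. -/
def IsExcluded (u : Fin r → ℕ) : Prop :=
  (∀ i, u i ≤ D.rho {i}) ∧ u ∉ D.carrier

/-- A minimal excluded vector of a discrete polymatroid. -/
def IsMinExcluded (u : Fin r → ℕ) : Prop :=
  D.IsExcluded u ∧ ∀ v, D.IsExcluded v → (∀ i, v i ≤ u i) → v = u

/-- The message index type of the index coding problem `I^D(Z,R)`:
`Sum.inl j` is the message `x_j` (`j ∈ {1,…,rank D}`), and `Sum.inr ⟨i,p⟩` is the message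
`y_i^p` (`i ∈ {1,…,r}`, `p ∈ {1,…,ρ({i})}`). -/
@[reducible] noncomputable def Msg : Type :=
  Fin D.rank ⊕ (Σ i : Fin r, Fin (D.rho {i}))

/-- The number of elements of a subset `T` of `Y` lying in `ζ_l = {y_l^1,…,y_l^{ρ({l})}}`. -/
noncomputable def sliceCard (T : Set (Σ i : Fin r, Fin (D.rho {i}))) (l : Fin r) : ℕ :=
  {p : Fin (D.rho {l}) | (⟨l, p⟩ : Σ i : Fin r, Fin (D.rho {i})) ∈ T}.ncard

/-- The index coding problem `I^D(Z,R)` constructed from the discrete polymatroid `D`,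
with receiver set `R = R1 ∪ R2 ∪ R3`. -/
noncomputable def indexProblem : IndexProblem D.Msg where
  recv :=
    -- R1
    {pr | ∃ b : Fin r → ℕ, D.IsBasisVec b ∧ ∃ j : Fin D.rank,
        ∃ T : Set (Σ i : Fin r, Fin (D.rho {i})),
          (∀ l : Fin r, D.sliceCard T l = b l) ∧
          pr = (Sum.inl j, Sum.inr '' T)} ∪
    -- R2
    {pr | ∃ c : Fin r → ℕ, D.IsMinExcluded c ∧ ∃ j : Fin r, c j ≠ 0 ∧
        ∃ p : Fin (D.rho {j}), ∃ T : Set (Σ i : Fin r, Fin (D.rho {i})),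
          (∀ l : Fin r, l ≠ j → D.sliceCard T l = c l) ∧
          D.sliceCard T j = c j - 1 ∧
          (⟨j, p⟩ : Σ i : Fin r, Fin (D.rho {i})) ∉ T ∧
          pr = (Sum.inr ⟨j, p⟩, Sum.inr '' T)} ∪
    -- R3
    {pr | ∃ (i : Fin r) (p : Fin (D.rho {i})),
        pr = (Sum.inr ⟨i, p⟩, Set.range Sum.inl)}

/-- `M(I^D(Z,R)) = ∑_{i=1}^r ρ({i})`: a perfect solution of dimension `n` has length
`n * indexCodeLen`. -/
noncomputable def indexCodeLen : ℕ := ∑ i : Fin r, D.rho {i}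

/-- The bound `N(D)` on the field size. -/
noncomputable def Nbound : ℕ :=
  1 + Finset.univ.sup fun i : Fin r =>
    ∑ b ∈ D.finite.toFinset.filter (fun b => D.IsBasisVec b ∧ 0 < b i),
      Nat.choose (D.rho {i}) (b i - 1) *
        ∏ j ∈ (Finset.univ.filter fun j : Fin r => b j ≠ 0).erase i,
          Nat.choose (D.rho {j}) (b j)

end DiscretePolymatroid

open Module Submodule in
/-- **Rado's theorem** for subspaces: a finite family of subspaces has a linearly independent
system of representatives as soon as any `k` of them span a space of dimension at least `k`. -/
theorem exists_linearIndependent_mem_of_card_le_finrank {K E κ : Type*} [Field K]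
    [AddCommGroup E] [Module K E] [FiniteDimensional K E] [Fintype κ] (N : κ → Submodule K E)
    (h : ∀ A : Finset κ, A.card ≤ finrank K ↥(⨆ a ∈ A, N a)) :
    ∃ v : κ → E, (∀ a, v a ∈ N a) ∧ LinearIndependent K v := by
  induction hs : ∑ a, finrank K (N a) using Nat.strong_induction_on generalizing N with
  | _ s ih =>
  by_cases hall : ∀ a, finrank K (N a) ≤ 1
  · have hone : ∀ a, finrank K (N a) = 1 := fun a =>
      le_antisymm (hall a) (by simpa using h {a})
    have hgen : ∀ a, ∃ v : E, N a = span K {v} := fun a => by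
      obtain ⟨v, hv, hv'⟩ := finrank_eq_one_iff'.1 (hone a)
      refine ⟨v, le_antisymm (fun w hw => ?_) (by simp)⟩
      obtain ⟨c, hc⟩ := hv' ⟨w, hw⟩
      exact mem_span_singleton.2 ⟨c, congrArg Subtype.val hc⟩
    choose v hv using hgen
    refine ⟨v, fun a => hv a ▸ mem_span_singleton_self _,
      linearIndependent_iff_card_le_finrank_span.2 ?_⟩
    have := h Finset.univ
    have hspan : (⨆ a ∈ Finset.univ, N a) = span K (Set.range v) := by
      simp [hv, span_range_eq_iSup]
    rwa [hspan] at this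
  push Not at hall
  obtain ⟨a₀, ha₀⟩ := hall
  have hpos : 0 < finrank K (N a₀) := by omega
  obtain ⟨v, hvN, hv0⟩ := (N a₀).exists_mem_ne_zero_of_ne_bot (by
    intro h0
    rw [h0, finrank_bot] at hpos
    exact hpos.false)
  obtain ⟨Q, hQ⟩ := (span K {v}).exists_isCompl
  have hHN : span K {v} ≤ N a₀ := by simpa using hvN
  have hsup : span K {v} ⊔ (Q ⊓ N a₀) = N a₀ := by
    rw [← sup_inf_assoc_of_le Q hHN, hQ.sup_eq_top, top_inf_eq]
  have hH : span K {v} < N a₀ := by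
    refine lt_of_le_of_ne hHN fun h0 => ?_
    rw [← h0, finrank_span_singleton hv0] at ha₀
    omega
  have hH' : Q ⊓ N a₀ < N a₀ := by
    refine lt_of_le_of_ne inf_le_right fun h0 => hv0 ?_
    have hvQ : v ∈ Q := (h0.symm ▸ hvN : v ∈ Q ⊓ N a₀).1
    exact disjoint_def.1 hQ.disjoint v (mem_span_singleton_self v) hvQ
  have split : ∀ (H : Submodule K E) (A : Finset κ),
      (⨆ a ∈ insert a₀ A, Function.update N a₀ H a) = H ⊔ ⨆ a ∈ A.erase a₀, N a := by
    intro H A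
    have hA : insert a₀ A = insert a₀ (A.erase a₀) := by
      ext a
      by_cases ha : a = a₀ <;> simp [ha]
    rw [hA, Finset.iSup_insert, Function.update_self]
    congr 1
    exact iSup_congr fun a => iSup_congr fun ha =>
      Function.update_of_ne (Finset.ne_of_mem_erase ha) _ _
  have shrink : ∀ H : Submodule K E, H < N a₀ →
      (∃ v : κ → E, (∀ a, v a ∈ N a) ∧ LinearIndependent K v) ∨
      ∃ A : Finset κ, a₀ ∉ A ∧ finrank K ↥(H ⊔ ⨆ a ∈ A, N a) ≤ A.card := by
    intro H hlt
    by_cases hc : ∀ A : Finset κ, A.card ≤ finrank K ↥(⨆ a ∈ A, Function.update N a₀ H a)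
    · left
      obtain ⟨w, hw, hli⟩ := ih (∑ a, finrank K (Function.update N a₀ H a)) (by
        rw [← hs]
        refine Finset.sum_lt_sum (fun a _ => ?_) ⟨a₀, Finset.mem_univ _, ?_⟩
        · by_cases ha : a = a₀
          · subst ha
            rw [Function.update_self]
            exact finrank_mono hlt.le
          · rw [Function.update_of_ne ha]
        · rw [Function.update_self]
          exact finrank_lt_finrank_of_lt hlt) _ hc rfl
      refine ⟨w, fun a => ?_, hli⟩
      have := hw a
      by_cases ha : a = a₀
      · subst ha
        exact hlt.le (by simpa using this)
      · simpa [Function.update_of_ne ha] using this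
    · right
      push Not at hc
      obtain ⟨A, hA⟩ := hc
      by_cases ha : a₀ ∈ A
      · refine ⟨A.erase a₀, by simp, ?_⟩
        rw [← split, Finset.insert_eq_of_mem ha, Finset.card_erase_of_mem ha]
        omega
      · have heq : (⨆ a ∈ A, Function.update N a₀ H a) = ⨆ a ∈ A, N a :=
          iSup_congr fun a => iSup_congr fun haA =>
            Function.update_of_ne (ne_of_mem_of_not_mem haA ha) _ _
        rw [heq] at hA
        exact absurd (h A) (by omega)
  rcases shrink _ hH with h1 | ⟨A, haA, hA⟩
  · exact h1
  rcases shrink _ hH' with h1 | ⟨B, haB, hB⟩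
  · exact h1
  exfalso
  have hmod := Submodule.finrank_sup_add_finrank_inf_eq
    (span K {v} ⊔ ⨆ a ∈ A, N a) (Q ⊓ N a₀ ⊔ ⨆ a ∈ B, N a)
  have hunion : (⨆ a ∈ insert a₀ (A ∪ B), N a) =
      (span K {v} ⊔ ⨆ a ∈ A, N a) ⊔ (Q ⊓ N a₀ ⊔ ⨆ a ∈ B, N a) := by
    rw [Finset.iSup_insert, Finset.iSup_union, sup_sup_sup_comm, hsup]
  have hinter : (⨆ a ∈ A ∩ B, N a) ≤
      (span K {v} ⊔ ⨆ a ∈ A, N a) ⊓ (Q ⊓ N a₀ ⊔ ⨆ a ∈ B, N a) :=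
    le_inf
      (le_sup_of_le_right (biSup_mono fun a ha => (Finset.mem_inter.1 ha).1))
      (le_sup_of_le_right (biSup_mono fun a ha => (Finset.mem_inter.1 ha).2))
  have h1 := h (insert a₀ (A ∪ B))
  rw [hunion, Finset.card_insert_of_notMem (by simp [haA, haB])] at h1
  have h2 := (h (A ∩ B)).trans (finrank_mono hinter)
  have h3 := Finset.card_union_add_card_inter A B
  omega

/-- A nonzero polynomial over a finite field has a nonzero value over some finite extension. -/
theorem MvPolynomial.exists_finite_extension_aeval_ne_zero {F σ : Type} [Field F] [Finite F]
    [Finite σ] (p : MvPolynomial σ F) (hp : p ≠ 0) :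
    ∃ (F' : Type) (_ : Field F') (_ : Fintype F') (_ : Algebra F F') (x : σ → F'),
      MvPolynomial.aeval x p ≠ 0 := by
  have hmap : MvPolynomial.map (algebraMap F (AlgebraicClosure F)) p ≠ 0 := fun h0 =>
    hp (MvPolynomial.map_injective _ (algebraMap F (AlgebraicClosure F)).injective
      (by simpa using h0))
  obtain ⟨x, hx⟩ : ∃ x : σ → AlgebraicClosure F, MvPolynomial.aeval x p ≠ 0 := by
    by_contra! hc
    refine hmap (MvPolynomial.funext fun x => ?_)
    rw [MvPolynomial.eval_map, ← MvPolynomial.aeval_def, hc x, map_zero]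
  obtain ⟨E, hE, hxE⟩ : ∃ E : IntermediateField F (AlgebraicClosure F), Finite E ∧ ∀ i, x i ∈ E := by
    refine ⟨IntermediateField.adjoin F (Set.range x), ?_, fun i =>
      IntermediateField.subset_adjoin F (Set.range x) ⟨i, rfl⟩⟩
    have : FiniteDimensional F (IntermediateField.adjoin F (Set.range x)) :=
      IntermediateField.finiteDimensional_adjoin fun z _ => Algebra.IsIntegral.isIntegral z
    exact Module.finite_of_finite F
  refine ⟨E, inferInstance, Fintype.ofFinite E, inferInstance, fun i => ⟨x i, hxE i⟩,
    fun h0 => hx ?_⟩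
  have hval := MvPolynomial.comp_aeval_apply (fun i => (⟨x i, hxE i⟩ : E)) E.val p
  rw [h0, map_zero] at hval
  exact hval.symm

open Submodule in
/-- Vectors in general position in prescribed subspaces, after a finite extension of the field:
any injectively indexed subfamily that can be made linearly independent is so. -/
theorem exists_finite_extension_generic {F κ τ : Type} [Field F] [Finite F] [Fintype κ] [Finite τ]
    (M : τ → Submodule F (κ → F)) :
    ∃ (F' : Type) (_ : Field F') (_ : Fintype F') (φ : F →+* F') (g : τ → κ → F'),
      (∀ t, g t ∈ span F' ((fun v : κ → F => φ ∘ v) '' M t)) ∧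
      ∀ e : κ → τ, Function.Injective e →
        (∃ v : κ → κ → F, (∀ a, v a ∈ M (e a)) ∧ LinearIndependent F v) →
        LinearIndependent F' fun a => g (e a) := by
  have hproj : ∀ t, ∃ P : (κ → F) →ₗ[F] (κ → F), (∀ v, P v ∈ M t) ∧ ∀ v ∈ M t, P v = v := by
    intro t
    obtain ⟨p, hp⟩ := (M t).subtype.exists_leftInverse_of_injective (M t).ker_subtype
    exact ⟨(M t).subtype ∘ₗ p, fun v => (p v).2, fun v hv =>
      congrArg Subtype.val (LinearMap.congr_fun hp ⟨v, hv⟩)⟩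
  choose P hPM hPid using hproj
  let G : τ → κ → MvPolynomial (τ × κ) F := fun t c =>
    ∑ a, MvPolynomial.X (t, a) * MvPolynomial.C (P t (Pi.single a 1) c)
  have haeval : ∀ {F' : Type} [Field F'] [Algebra F F'] (x : τ × κ → F') (t : τ),
      (fun c => MvPolynomial.aeval x (G t c)) =
        ∑ a, x (t, a) • (algebraMap F F' ∘ P t (Pi.single a 1)) := by
    intro F' _ _ x t
    ext c
    simp [G]
  have hdet : ∀ {F' : Type} [Field F'] [Algebra F F'] (x : τ × κ → F') (e : κ → τ),
      MvPolynomial.aeval x (Matrix.of fun a => G (e a)).det ≠ 0 ↔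
        LinearIndependent F' fun a c => MvPolynomial.aeval x (G (e a) c) := by
    intro F' _ _ x e
    rw [AlgHom.map_det, ← isUnit_iff_ne_zero, ← Matrix.isUnit_iff_isUnit_det,
      ← Matrix.linearIndependent_rows_iff_isUnit]
    rfl
  let S : Finset (κ → τ) := (Set.toFinite {e : κ → τ | Function.Injective e ∧
    ∃ v : κ → κ → F, (∀ a, v a ∈ M (e a)) ∧ LinearIndependent F v}).toFinset
  have hS : ∏ e ∈ S, (Matrix.of fun a => G (e a)).det ≠ 0 := by
    refine Finset.prod_ne_zero_iff.2 fun e he h0 => ?_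
    obtain ⟨hinj, v, hvM, hli⟩ := (Set.Finite.mem_toFinset _).1 he
    refine (hdet (fun y : τ × κ => Function.extend e v 0 y.1 y.2) e).2 ?_ (by rw [h0, map_zero])
    convert hli using 2 with a
    rw [haeval]
    simp only [hinj.extend_apply, Algebra.algebraMap_self]
    conv_rhs => rw [← hPid _ _ (hvM a), pi_eq_sum_univ' (v a), map_sum]
    refine Finset.sum_congr rfl fun b _ => ?_
    rw [map_smul]
    rfl
  obtain ⟨F', _, _, _, x, hx⟩ := MvPolynomial.exists_finite_extension_aeval_ne_zero _ hS
  refine ⟨F', inferInstance, inferInstance, algebraMap F F',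
    fun t c => MvPolynomial.aeval x (G t c), fun t => ?_, fun e he hv => ?_⟩
  · beta_reduce
    rw [haeval]
    exact sum_mem fun a _ => smul_mem _ _ (subset_span ⟨_, hPM t _, rfl⟩)
  · rw [← hdet]
    rw [map_prod] at hx
    exact Finset.prod_ne_zero_iff.1 hx e ((Set.Finite.mem_toFinset _).2 ⟨he, hv⟩)

open Submodule Module in
/-- Extension of scalars does not increase the dimension of a space of coordinate vectors. -/
theorem finrank_span_image_comp_le {F F' κ : Type*} [Field F] [Field F'] [Finite κ]
    (φ : F →+* F') (W : Submodule F (κ → F)) :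
    finrank F' (span F' ((fun v : κ → F => φ ∘ v) '' W)) ≤ finrank F W := by
  let b := finBasis F W
  have hle : span F' ((fun v : κ → F => φ ∘ v) '' W) ≤
      span F' (Set.range fun i => φ ∘ (b i : κ → F)) := by
    rw [span_le]
    rintro _ ⟨v, hv, rfl⟩
    have hsum : φ ∘ v = ∑ i, φ (b.repr ⟨v, hv⟩ i) • (φ ∘ (b i : κ → F)) := by
      have := congrArg Subtype.val (b.sum_repr ⟨v, hv⟩)
      ext c
      have hc : (∑ i, b.repr ⟨v, hv⟩ i • (b i : κ → F)) c = v c := by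
        simpa [-Basis.sum_repr] using congrFun this c
      simp [← hc]
    simp only [hsum]
    exact sum_mem fun i _ => smul_mem _ _ (subset_span ⟨i, rfl⟩)
  exact (finrank_mono hle).trans ((finrank_range_le_card _).trans (by simp))

open Submodule in
/-- A vector lies in the span of `s` if and only if it is orthogonal to the orthogonal of `s`. -/
theorem mem_span_iff_forall_dotProduct_eq_zero {F κ : Type*} [Field F] [Fintype κ]
    {s : Set (κ → F)} {h : κ → F} :
    h ∈ span F s ↔ ∀ x, (∀ a ∈ s, a ⬝ᵥ x = 0) → h ⬝ᵥ x = 0 := by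
  constructor
  · intro hh x hx
    induction hh using span_induction with
    | mem a ha => exact hx a ha
    | zero => simp
    | add a b _ _ ha hb => rw [add_dotProduct, ha, hb, add_zero]
    | smul c a _ ha => rw [smul_dotProduct, ha, smul_zero]
  · intro hx
    by_contra hh
    obtain ⟨f, hf, hle⟩ := exists_le_ker_of_notMem hh
    have hdot : ∀ a, a ⬝ᵥ (fun c => f (Pi.single c 1)) = f a := fun a => by
      conv_rhs => rw [pi_eq_sum_univ' a]
      simp [dotProduct]
    exact hf (by rw [← hdot]; exact hx _ fun a ha => by rw [hdot]; exact hle (subset_span ha))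


theorem setSum_univ {r : ℕ} (u : Fin r → ℕ) : setSum u Set.univ = ∑ i, u i := by
  simp [setSum]

theorem setSum_singleton {r : ℕ} (u : Fin r → ℕ) (i : Fin r) : setSum u {i} = u i := by
  simp [setSum, Finset.sum_filter]

namespace DiscretePolymatroid

variable {r : ℕ} {D : DiscretePolymatroid r}

theorem setSum_le_rho {u : Fin r → ℕ} (hu : u ∈ D.carrier) (A : Set (Fin r)) :
    setSum u A ≤ D.rho A :=
  Finset.le_sup (f := fun u => setSum u A) (D.finite.mem_toFinset.2 hu)

theorem le_rho_singleton {u : Fin r → ℕ} (hu : u ∈ D.carrier) (i : Fin r) : u i ≤ D.rho {i} :=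
  setSum_singleton u i ▸ setSum_le_rho hu {i}

theorem exists_setSum_eq_rho (D : DiscretePolymatroid r) (A : Set (Fin r)) :
    ∃ u ∈ D.carrier, setSum u A = D.rho A := by
  obtain ⟨u, hu, h⟩ := Finset.exists_mem_eq_sup D.finite.toFinset
    (D.finite.toFinset_nonempty.2 D.nonempty) fun u => setSum u A
  exact ⟨u, D.finite.mem_toFinset.1 hu, h.symm⟩

theorem exists_isBasisVec_ge {u : Fin r → ℕ} (hu : u ∈ D.carrier) :
    ∃ b, D.IsBasisVec b ∧ ∀ i, u i ≤ b i := by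
  obtain ⟨b, hub, hb⟩ := D.finite.exists_le_maximal hu
  exact ⟨b, ⟨hb.prop, fun v hv hbv => le_antisymm (hb.le_of_ge hv hbv) hbv⟩, hub⟩

theorem IsBasisVec.sum_eq_rank {b : Fin r → ℕ} (hb : D.IsBasisVec b) : ∑ i, b i = D.rank := by
  refine le_antisymm (setSum_univ b ▸ setSum_le_rho hb.1 Set.univ) ?_
  obtain ⟨v, hv, hvr⟩ := D.exists_setSum_eq_rho Set.univ
  rw [rank, ← hvr, setSum_univ]
  by_contra! hlt
  obtain ⟨w, hw, hbw, hne, -⟩ := D.exchange b hb.1 v hv hlt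
  exact hne (hb.2 w hw hbw).symm

theorem exists_isBasisVec_setSum_eq_rho (D : DiscretePolymatroid r) (A : Set (Fin r)) :
    ∃ b, D.IsBasisVec b ∧ setSum b A = D.rho A := by
  obtain ⟨u, hu, hA⟩ := D.exists_setSum_eq_rho A
  obtain ⟨b, hb, hub⟩ := exists_isBasisVec_ge hu
  exact ⟨b, hb, le_antisymm (setSum_le_rho hb.1 A)
    (hA ▸ Finset.sum_le_sum fun i _ => hub i)⟩

theorem IsExcluded.exists_isMinExcluded_le {u : Fin r → ℕ} (hu : D.IsExcluded u) :
    ∃ c, D.IsMinExcluded c ∧ ∀ i, c i ≤ u i := by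
  have hfin : {v | D.IsExcluded v}.Finite :=
    (Set.finite_Iic fun i => D.rho {i}).subset fun v hv => hv.1
  obtain ⟨c, hcu, hc⟩ := hfin.exists_le_minimal hu
  exact ⟨c, ⟨hc.prop, fun v hv hvc => le_antisymm hvc (hc.le_of_le hv hvc)⟩, hcu⟩

theorem IsMinExcluded.sub_single_mem {c : Fin r → ℕ} (hc : D.IsMinExcluded c) {j : Fin r}
    (hj : c j ≠ 0) : c - Pi.single j 1 ∈ D.carrier := by
  by_contra hn
  have hle : ∀ i, (c - Pi.single j 1 : Fin r → ℕ) i ≤ c i := fun i => Nat.sub_le _ _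
  have := congrFun (hc.2 _ ⟨fun i => (hle i).trans (hc.1.1 i), hn⟩ hle) j
  simp at this
  omega

theorem sum_sub_single {c : Fin r → ℕ} {j : Fin r} (hj : c j ≠ 0) :
    ∑ i, (c - Pi.single j 1 : Fin r → ℕ) i + 1 = ∑ i, c i := by
  have h : c - Pi.single j 1 + Pi.single j 1 = c := by
    ext i
    by_cases hi : i = j
    · subst hi
      simp
      omega
    · simp [hi]
  conv_rhs => rw [← h]
  simp only [Pi.add_apply, Finset.sum_add_distrib, Finset.sum_pi_single', Finset.mem_univ, if_true]

theorem IsMinExcluded.sum_lt {c v : Fin r → ℕ} (hc : D.IsMinExcluded c) (hv : v ∈ D.carrier)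
    (hvc : ∀ i, c i = 0 → v i = 0) : ∑ i, v i < ∑ i, c i := by
  by_contra! hle
  have swap : ∀ j, c j ≠ 0 → ∀ w ∈ D.carrier, ∑ i, c i ≤ ∑ i, w i →
      ∃ m, m ≠ j ∧ c m < w m ∧ c - Pi.single j 1 + Pi.single m 1 ∈ D.carrier := by
    intro j hj w hw hcw
    obtain ⟨x, hx, hcx, hne, hxw⟩ := D.exchange _ (hc.sub_single_mem hj) w hw
      (by have := sum_sub_single hj; omega)
    obtain ⟨m, hm⟩ : ∃ m, (c - Pi.single j 1 : Fin r → ℕ) m < x m := by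
      by_contra! hcon
      exact hne (funext fun i => le_antisymm (hcx i) (hcon i))
    have hmem : c - Pi.single j 1 + Pi.single m 1 ∈ D.carrier := by
      refine D.lower x hx _ fun i => ?_
      by_cases hi : i = m
      · subst hi
        simpa using hm
      · simpa [hi] using hcx i
    have hmj : m ≠ j := by
      rintro rfl
      refine hc.1.2 (D.lower _ hmem _ fun i => ?_)
      simp only [Pi.add_apply, Pi.sub_apply]
      omega
    refine ⟨m, hmj, ?_, hmem⟩
    have := hxw m
    simp only [Pi.sub_apply, Pi.single_eq_of_ne hmj] at this hm
    omega
  obtain ⟨j, hj⟩ : ∃ j, c j ≠ 0 := by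
    by_contra! h0
    exact hc.1.2 (D.lower v hv c fun i => by simp [h0 i])
  obtain ⟨m, hmj, hm, hmem⟩ := swap j hj v hv hle
  have hcm : c m ≠ 0 := fun h0 => by simp [h0, hvc m h0] at hm
  obtain ⟨q, hqm, hq, -⟩ := swap m hcm _ hmem (by
    have := sum_sub_single hj
    simp only [Pi.add_apply, Finset.sum_add_distrib, Finset.sum_pi_single', Finset.mem_univ,
      if_true]
    omega)
  simp only [Pi.add_apply, Pi.sub_apply, Pi.single_eq_of_ne hqm] at hq
  omega

/-- The support of a minimal excluded vector has rank less than the size of the vector. -/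
theorem IsMinExcluded.rho_support_lt {c : Fin r → ℕ} (hc : D.IsMinExcluded c) :
    D.rho {i | c i ≠ 0} < ∑ i, c i := by
  obtain ⟨u, hu, hur⟩ := D.exists_setSum_eq_rho {i | c i ≠ 0}
  rw [← hur, setSum, Finset.sum_filter]
  refine hc.sum_lt (D.lower u hu _ fun i => ?_) fun i hi => if_neg fun h => h hi
  split_ifs <;> simp

/-- If a vector of `D` attains the rank of `X`, then raising a coordinate in `X` within its bound
creates a minimal excluded vector supported in `X`. -/
theorem exists_isMinExcluded_of_setSum_eq_rho {b : Fin r → ℕ} (hb : b ∈ D.carrier)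
    {X : Set (Fin r)} (hX : setSum b X = D.rho X) {j : Fin r} (hj : j ∈ X)
    (hbj : b j < D.rho {j}) :
    ∃ c, D.IsMinExcluded c ∧ c j = b j + 1 ∧ (∀ l, l ≠ j → c l ≤ b l) ∧ ∀ l ∉ X, c l = 0 := by
  let u : Fin r → ℕ := fun i => (if i ∈ X then b i else 0) + (Pi.single j 1 : Fin r → ℕ) i
  have hu : D.IsExcluded u := by
    refine ⟨fun i => ?_, fun hu => ?_⟩
    · by_cases hi : i = j
      · subst hi
        simpa [u, hj] using hbj
      · have := le_rho_singleton hb i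
        simp only [u, Pi.single_eq_of_ne hi]
        split_ifs <;> omega
    · have h1 := setSum_le_rho hu X
      rw [← hX, setSum, setSum, Finset.sum_add_distrib, Finset.sum_pi_single',
        if_pos (by simpa using hj)] at h1
      have h2 : ∑ i with i ∈ X, (if i ∈ X then b i else 0) = ∑ i with i ∈ X, b i :=
        Finset.sum_congr rfl fun i hi => if_pos (Finset.mem_filter.1 hi).2
      omega
  obtain ⟨c, hc, hcu⟩ := hu.exists_isMinExcluded_le
  have hne : ∀ l, l ≠ j → c l ≤ if l ∈ X then b l else 0 := fun l hl => by
    simpa [u, hl] using hcu l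
  have hcb : ∀ l, l ≠ j → c l ≤ b l := fun l hl => (hne l hl).trans (by split_ifs <;> simp)
  refine ⟨c, hc, le_antisymm (by simpa [u, hj] using hcu j) ?_, hcb, fun l hl => ?_⟩
  · by_contra! hlt
    refine hc.1.2 (D.lower b hb c fun i => ?_)
    by_cases hi : i = j
    · subst hi
      omega
    · exact hcb i hi
  · simpa [hl] using hne l (fun h => hl (h ▸ hj))

theorem ncard_sep_eq_setSum_sliceCard (D : DiscretePolymatroid r)
    (T : Set (Σ i : Fin r, Fin (D.rho {i}))) (X : Set (Fin r)) :
    {t | t ∈ T ∧ t.1 ∈ X}.ncard = setSum (D.sliceCard T) X := by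
  rw [Set.ncard_eq_toFinset_card', setSum,
    Finset.card_eq_sum_card_fiberwise (f := Sigma.fst) (t := Finset.univ.filter (· ∈ X))
      (fun t ht => by simpa using (Set.mem_toFinset.1 ht).2)]
  refine Finset.sum_congr rfl fun i hi => ?_
  rw [sliceCard, Set.ncard_eq_toFinset_card']
  symm
  refine Finset.card_bij (fun p _ => ⟨i, p⟩) (fun p hp => ?_) (fun p _ q _ h => by simpa using h) ?_
  · simpa using ⟨by simpa using hp, by simpa using hi⟩
  · rintro ⟨l, p⟩ ht
    simp only [Finset.mem_filter, Set.mem_toFinset, Set.mem_ofPred_eq] at ht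
    obtain ⟨⟨hT, -⟩, rfl⟩ := ht
    exact ⟨p, by simpa using hT, rfl⟩

theorem ncard_eq_sum_sliceCard (D : DiscretePolymatroid r)
    (T : Set (Σ i : Fin r, Fin (D.rho {i}))) : T.ncard = ∑ i, D.sliceCard T i := by
  simpa [setSum_univ] using D.ncard_sep_eq_setSum_sliceCard T Set.univ

/-- The set of messages `y_i^p` with `p` among the first `u i` indices. -/
def initialSlices (D : DiscretePolymatroid r) (u : Fin r → ℕ) :
    Set (Σ i : Fin r, Fin (D.rho {i})) :=
  {t | (t.2 : ℕ) < u t.1}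

theorem sliceCard_initialSlices {u : Fin r → ℕ} {l : Fin r} (h : u l ≤ D.rho {l}) :
    D.sliceCard (D.initialSlices u) l = u l := by
  have : {p : Fin (D.rho {l}) | (⟨l, p⟩ : Σ i : Fin r, Fin (D.rho {i})) ∈ D.initialSlices u} =
      Set.range (Fin.castLE h) := by
    ext p
    exact ⟨fun hp => ⟨⟨p, hp⟩, rfl⟩, by rintro ⟨q, rfl⟩; exact q.2⟩
  rw [sliceCard, this, ← Set.image_univ,
    Set.ncard_image_of_injective _ (Fin.castLE_injective h), Set.ncard_univ, Nat.card_eq_fintype_card,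
    Fintype.card_fin]

theorem exists_superset_sliceCard_eq {T : Set (Σ i : Fin r, Fin (D.rho {i}))} {b : Fin r → ℕ}
    (hT : ∀ l, D.sliceCard T l ≤ b l) (hb : ∀ l, b l ≤ D.rho {l}) :
    ∃ T', T ⊆ T' ∧ ∀ l, D.sliceCard T' l = b l := by
  have h : ∀ l, ∃ P : Set (Fin (D.rho {l})), {p | ⟨l, p⟩ ∈ T} ⊆ P ∧ P.ncard = b l := fun l => by
    obtain ⟨P, h1, -, h2⟩ := Set.exists_subsuperset_card_eq (Set.subset_univ {p | ⟨l, p⟩ ∈ T})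
      (hT l) (by simpa [Set.ncard_univ] using hb l)
    exact ⟨P, h1, h2⟩
  choose P hP hPb using h
  exact ⟨{t | t.2 ∈ P t.1}, fun t ht => hP t.1 ht, hPb⟩

end DiscretePolymatroid


open Module Submodule in
theorem LinearIndepOn.finrank_span_image_eq_ncard {K E ι : Type*} [Field K] [AddCommGroup E]
    [Module K E] {g : ι → E} {s : Set ι} [Finite s] (h : LinearIndepOn K g s) :
    finrank K (span K (g '' s)) = s.ncard := by
  have := Fintype.ofFinite s
  rw [Set.image_eq_range, finrank_span_eq_card h, ← Nat.card_coe_set_eq, Nat.card_eq_fintype_card]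

open Module Submodule in
theorem linearIndepOn_of_span_image_eq_top {K E ι : Type*} [Field K] [AddCommGroup E]
    [Module K E] {g : ι → E} {s : Set ι} [Finite s] (h : span K (g '' s) = ⊤)
    (hs : s.ncard = finrank K E) : LinearIndepOn K g s := by
  have := Fintype.ofFinite s
  refine linearIndependent_of_top_le_span_of_card_eq_finrank ?_ ?_
  · rw [← Set.image_eq_range, h]
  · rw [← hs, ← Nat.card_coe_set_eq, Nat.card_eq_fintype_card]

theorem LinearMap.exists_comp_eq_of_forall_eq_zero {K E A B : Type*} [Field K] [AddCommGroup E]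
    [Module K E] [AddCommGroup A] [Module K A] [AddCommGroup B] [Module K B] (f : E →ₗ[K] A)
    (h : E →ₗ[K] B) (hfh : ∀ x, f x = 0 → h x = 0) : ∃ ψ : A →ₗ[K] B, ∀ x, ψ (f x) = h x := by
  obtain ⟨ψ, hψ⟩ := LinearMap.exists_extend
    ((LinearMap.ker f).liftQ h (fun x hx => hfh x hx) ∘ₗ f.quotKerEquivRange.symm.toLinearMap)
  refine ⟨ψ, fun x => ?_⟩
  have := LinearMap.congr_fun hψ ⟨f x, x, rfl⟩
  have hx : f.quotKerEquivRange.symm ⟨f x, x, rfl⟩ = (LinearMap.ker f).mkQ x := by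
    rw [LinearEquiv.symm_apply_eq]
    rfl
  exact this.trans (congrArg ((LinearMap.ker f).liftQ h fun x hx => hfh x hx) hx)

namespace DiscretePolymatroid

variable {r : ℕ} {D : DiscretePolymatroid r}

/-- A vector configuration satisfying the decodability conditions of the receivers in `R1` and
`R2`: the vectors `g (y, s)`, `s < n`, are the rows of the linear map that expresses the
message `y` in terms of the messages in `X`. -/
def IsCodeConfiguration (D : DiscretePolymatroid r) {F : Type} [Field F] {n : ℕ}
    (g : (Σ i : Fin r, Fin (D.rho {i})) × Fin n → Fin D.rank × Fin n → F) : Prop :=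
  (∀ b, D.IsBasisVec b → ∀ T, (∀ l, D.sliceCard T l = b l) →
    Submodule.span F (g '' (T ×ˢ Set.univ)) = ⊤) ∧
  ∀ c, D.IsMinExcluded c → ∀ j, c j ≠ 0 → ∀ p T, (∀ l, l ≠ j → D.sliceCard T l = c l) →
    D.sliceCard T j = c j - 1 → ⟨j, p⟩ ∉ T →
    ∀ s, g (⟨j, p⟩, s) ∈ Submodule.span F (g '' (T ×ˢ Set.univ))

theorem exists_isCodeConfiguration_of_hasLinearIndexCode {F : Type} [Field F] {n : ℕ}
    (h : HasLinearIndexCode D.indexProblem F n (n * D.indexCodeLen)) :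
    ∃ g : (Σ i : Fin r, Fin (D.rho {i})) × Fin n → Fin D.rank × Fin n → F,
      D.IsCodeConfiguration g := by
  obtain ⟨f, hf⟩ := h
  have decode : ∀ z H, (z, H) ∈ D.indexProblem.recv → ∀ y : D.Msg → Fin n → F,
      f y = 0 → (∀ m ∈ H, y m = 0) → y z = 0 := by
    intro z H hzH y hy hyH
    obtain ⟨ψ, hψ⟩ := hf _ hzH
    have h0 : (fun m : H => y m.1) = 0 := funext fun m => hyH m.1 m.2
    rw [← hψ y, hy, h0]
    exact map_zero ψ
  let S := (LinearEquiv.sumArrowLequivProdArrow (Fin D.rank) (Σ i : Fin r, Fin (D.rho {i})) F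
    (Fin n → F)).symm
  let fX := f ∘ₗ S.toLinearMap ∘ₗ LinearMap.inl F _ _
  let fY := f ∘ₗ S.toLinearMap ∘ₗ LinearMap.inr F _ _
  have hinj : Function.Injective fY := by
    refine (injective_iff_map_eq_zero fY).2 fun y hy => funext fun t => ?_
    refine decode (Sum.inr t) (Set.range Sum.inl) (Or.inr ⟨t.1, t.2, rfl⟩) (S (0, y)) hy ?_
    rintro _ ⟨j, rfl⟩
    rfl
  let e := LinearEquiv.ofInjectiveOfFinrankEq fY hinj (by
      rw [Module.finrank_fin_fun, indexCodeLen]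
      simp [mul_comm, Module.finrank_pi_fintype])
  let L := -(e.symm.toLinearMap ∘ₗ fX)
  have hfL : ∀ x, f (S (x, L x)) = 0 := by
    intro x
    have h1 : f (S (x, L x)) = fX x + fY (L x) := by
      simp only [fX, fY, LinearMap.comp_apply, ← map_add]
      simp
    have h2 : fY (L x) = -fX x := by
      have : fY (L x) = e (L x) := rfl
      rw [this]
      simp [L]
    rw [h1, h2, add_neg_cancel]
  let g : (Σ i : Fin r, Fin (D.rho {i})) × Fin n → Fin D.rank × Fin n → F :=
    fun t q => L (Pi.single q.1 (Pi.single q.2 1)) t.1 t.2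
  have hg : ∀ t s (x : Fin D.rank → Fin n → F),
      L x t s = g (t, s) ⬝ᵥ fun q => x q.1 q.2 := by
    intro t s x
    have hx : x = ∑ j, ∑ q, x j q • (Pi.single j (Pi.single q 1) : Fin D.rank → Fin n → F) := by
      ext j q
      simp [Finset.sum_apply, Pi.single_apply, ite_apply]
    conv_lhs => rw [hx]
    simp [dotProduct, g, Fintype.sum_prod_type, map_sum, Finset.sum_apply, mul_comm]
  have hzero : ∀ (x : Fin D.rank × Fin n → F) (T : Set (Σ i : Fin r, Fin (D.rho {i}))),
      (∀ a ∈ g '' (T ×ˢ Set.univ), a ⬝ᵥ x = 0) → ∀ m ∈ Sum.inr '' T,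
        S (fun j s => x (j, s), L fun j s => x (j, s)) m = 0 := by
    rintro x T hx _ ⟨t, ht, rfl⟩
    funext s
    exact (hg t s _).trans (hx _ ⟨(t, s), ⟨ht, trivial⟩, rfl⟩)
  refine ⟨g, fun b hb T hT => ?_, fun c hc j hj p T hT hTj hp s => ?_⟩
  · refine eq_top_iff.2 fun v _ => mem_span_iff_forall_dotProduct_eq_zero.2 fun x hx => ?_
    have : x = 0 := funext fun q => congrFun
      (decode (Sum.inl q.1) (Sum.inr '' T) (Or.inl (Or.inl ⟨b, hb, q.1, T, hT, rfl⟩))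
        _ (hfL fun j s => x (j, s)) (hzero x T hx)) q.2
    rw [this, dotProduct_zero]
  · refine mem_span_iff_forall_dotProduct_eq_zero.2 fun x hx => ?_
    exact (hg _ s _).symm.trans (congrFun
      (decode (Sum.inr ⟨j, p⟩) (Sum.inr '' T)
        (Or.inl (Or.inr ⟨c, hc, j, hj, p, T, hT, hTj, hp, rfl⟩))
        _ (hfL fun j s => x (j, s)) (hzero x T hx)) s)

theorem IsCodeConfiguration.hasLinearIndexCode {F : Type} [Field F] {n : ℕ}
    {g : (Σ i : Fin r, Fin (D.rho {i})) × Fin n → Fin D.rank × Fin n → F}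
    (hg : D.IsCodeConfiguration g) :
    HasLinearIndexCode D.indexProblem F n (n * D.indexCodeLen) := by
  let f₀ : (D.Msg → Fin n → F) →ₗ[F] ((Σ i : Fin r, Fin (D.rho {i})) → Fin n → F) :=
    { toFun := fun y t s => y (Sum.inr t) s - g (t, s) ⬝ᵥ fun q => y (Sum.inl q.1) q.2
      map_add' := fun y z => by
        ext t s
        have := dotProduct_add (g (t, s)) (fun q => y (Sum.inl q.1) q.2)
          (fun q => z (Sum.inl q.1) q.2)
        exact (congrArg (y (Sum.inr t) s + z (Sum.inr t) s - ·) this).trans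
          (add_sub_add_comm _ _ _ _)
      map_smul' := fun a y => by
        ext t s
        have := dotProduct_smul a (g (t, s)) (fun q => y (Sum.inl q.1) q.2)
        exact (congrArg (a • y (Sum.inr t) s - ·) this).trans (smul_sub _ _ _).symm }
  have hf₀ : ∀ y, f₀ y = 0 → ∀ t s, y (Sum.inr t) s = g (t, s) ⬝ᵥ fun q => y (Sum.inl q.1) q.2 :=
    fun y hy t s => sub_eq_zero.1 (congrFun (congrFun hy t) s)
  let e : ((Σ i : Fin r, Fin (D.rho {i})) → Fin n → F) ≃ₗ[F] (Fin (n * D.indexCodeLen) → F) :=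
    LinearEquiv.ofFinrankEq _ _ (by
      rw [Module.finrank_fin_fun, indexCodeLen]
      simp [mul_comm, Module.finrank_pi_fintype])
  have ortho : ∀ y, f₀ y = 0 → ∀ T : Set (Σ i : Fin r, Fin (D.rho {i})),
      (∀ m ∈ (Sum.inr '' T : Set D.Msg), y m = 0) →
      ∀ a ∈ g '' (T ×ˢ Set.univ), (a ⬝ᵥ fun q => y (Sum.inl q.1) q.2) = 0 := by
    rintro y hy T hT _ ⟨⟨t, s⟩, ⟨ht, -⟩, rfl⟩
    rw [← hf₀ y hy t s, hT _ ⟨t, ht, rfl⟩, Pi.zero_apply]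
  refine ⟨e.toLinearMap ∘ₗ f₀, fun ⟨z, H⟩ hzH => ?_⟩
  let φ : (D.Msg → Fin n → F) →ₗ[F] ((H → Fin n → F) × (Fin (n * D.indexCodeLen) → F)) :=
    (LinearMap.funLeft F (Fin n → F) (fun m : H => m.1)).prod (e.toLinearMap ∘ₗ f₀)
  refine LinearMap.exists_comp_eq_of_forall_eq_zero φ (LinearMap.proj z) fun y hy => ?_
  have hy0 : f₀ y = 0 := by simpa [φ] using congrArg Prod.snd hy
  have hyH : ∀ m ∈ H, y m = 0 := fun m hm => congrFun (congrArg Prod.fst hy) ⟨m, hm⟩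
  show y z = 0
  rcases hzH with (⟨b, hb, j, T, hT, h⟩ | ⟨c, hc, j, hj, p, T, hT, hTj, hp, h⟩) | ⟨i, p, h⟩ <;>
    obtain ⟨rfl, rfl⟩ := Prod.mk.inj h
  · funext s
    have hmem : (Pi.single (j, s) 1 : Fin D.rank × Fin n → F) ∈
        Submodule.span F (g '' (T ×ˢ Set.univ)) := by
      rw [hg.1 b hb T hT]
      trivial
    simpa using mem_span_iff_forall_dotProduct_eq_zero.1 hmem _ (ortho y hy0 T hyH)
  · funext s
    exact (hf₀ y hy0 _ s).trans (mem_span_iff_forall_dotProduct_eq_zero.1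
      (hg.2 c hc j hj p T hT hTj hp s) _ (ortho y hy0 T hyH))
  · funext s
    rw [hf₀ y hy0]
    simp [hyH _ ⟨_, rfl⟩]

theorem ncard_prod_univ_eq_finrank {F : Type} [Field F] {n : ℕ} {b : Fin r → ℕ}
    (hb : D.IsBasisVec b) {T : Set (Σ i : Fin r, Fin (D.rho {i}))}
    (hT : ∀ l, D.sliceCard T l = b l) :
    (T ×ˢ (Set.univ : Set (Fin n))).ncard = Module.finrank F (Fin D.rank × Fin n → F) := by
  simp [Set.ncard_prod, ncard_eq_sum_sliceCard, hT, hb.sum_eq_rank, Set.ncard_univ]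

open Submodule Module in
theorem IsCodeConfiguration.repFnOver {F : Type} [Field F] {n : ℕ}
    {g : (Σ i : Fin r, Fin (D.rho {i})) × Fin n → Fin D.rank × Fin n → F}
    (hg : D.IsCodeConfiguration g) : RepFnOver r (fun X => n * D.rho X) F := by
  let V : Fin r → Submodule F (Fin D.rank × Fin n → F) := fun i => span F (g '' {q | q.1.1 = i})
  have hV : ∀ X : Set (Fin r), finrank F ↥(⨆ i ∈ X, V i) = n * D.rho X := by
    intro X
    obtain ⟨b, hb, hbX⟩ := D.exists_isBasisVec_setSum_eq_rho X
    let T := D.initialSlices b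
    have hT : ∀ l, D.sliceCard T l = b l := fun l => sliceCard_initialSlices (le_rho_singleton hb.1 l)
    have hli : LinearIndepOn F g (T ×ˢ Set.univ) :=
      linearIndepOn_of_span_image_eq_top (hg.1 b hb T hT) (ncard_prod_univ_eq_finrank hb hT)
    have hsub : {t | t ∈ T ∧ t.1 ∈ X} ×ˢ (Set.univ : Set (Fin n)) ⊆ T ×ˢ Set.univ :=
      Set.prod_mono (fun t ht => ht.1) le_rfl
    have hspan : (⨆ i ∈ X, V i) = span F (g '' ({t | t ∈ T ∧ t.1 ∈ X} ×ˢ Set.univ)) := by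
      refine le_antisymm (iSup₂_le fun i hi => span_le.2 ?_) (span_le.2 ?_)
      · rintro _ ⟨⟨⟨j, p⟩, s⟩, hji, rfl⟩
        obtain rfl : j = i := hji
        by_cases hp : (p : ℕ) < b j
        · exact subset_span ⟨(⟨j, p⟩, s), ⟨⟨hp, hi⟩, trivial⟩, rfl⟩
        obtain ⟨c, hc, hcj, hcb, hcX⟩ :=
          exists_isMinExcluded_of_setSum_eq_rho hb.1 hbX hi (by omega)
        have hle : ∀ l, (c - Pi.single j 1 : Fin r → ℕ) l ≤ b l := fun l => by
          by_cases hl : l = j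
          · subst hl
            simp [hcj]
          · simpa [hl] using hcb l hl
        have hslice : ∀ l, D.sliceCard (D.initialSlices (c - Pi.single j 1)) l =
            (c - Pi.single j 1 : Fin r → ℕ) l := fun l =>
          sliceCard_initialSlices ((hle l).trans (le_rho_singleton hb.1 l))
        refine span_mono (Set.image_mono (Set.prod_mono ?_ le_rfl))
          (hg.2 c hc j (by omega) p (D.initialSlices (c - Pi.single j 1))
            (fun l hl => by rw [hslice]; simp [hl]) (by rw [hslice]; simp) ?_ s)
        · intro t ht
          have ht' : (t.2 : ℕ) < (c - Pi.single j 1 : Fin r → ℕ) t.1 := ht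
          refine ⟨ht'.trans_le (hle _), ?_⟩
          by_contra htX
          simp [hcX _ htX] at ht'
        · intro hmem
          exact hp (lt_of_lt_of_le hmem (hle j))
      · rintro _ ⟨⟨t, s⟩, ⟨ht, -⟩, rfl⟩
        exact mem_iSup_of_mem t.1 (mem_iSup_of_mem ht.2 (subset_span ⟨_, rfl, rfl⟩))
    rw [hspan, (hli.mono hsub).finrank_span_image_eq_ncard, Set.ncard_prod,
      D.ncard_sep_eq_setSum_sliceCard, funext hT, hbX, Set.ncard_univ, Nat.card_eq_fintype_card,
      Fintype.card_fin, mul_comm]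
  let e := LinearEquiv.funCongrLeft F F (finProdFinEquiv (m := D.rank) (n := n)).symm
  refine ⟨D.rank * n, fun i => (V i).map e.toLinearMap, fun X => ?_⟩
  have hmap : (⨆ i ∈ X, (V i).map e.toLinearMap) = (⨆ i ∈ X, V i).map e.toLinearMap := by
    simp only [Submodule.map_iSup]
  rw [hmap]
  exact (LinearEquiv.finrank_map_eq e _).trans (hV X)

open Submodule Module in
theorem exists_isCodeConfiguration_of_repFnOver {F : Type} [Field F] [Finite F] {n : ℕ}
    (h : RepFnOver r (fun X => n * D.rho X) F) :
    ∃ (F' : Type) (_ : Field F') (_ : Fintype F')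
      (g : (Σ i : Fin r, Fin (D.rho {i})) × Fin n → Fin D.rank × Fin n → F'),
      D.IsCodeConfiguration g := by
  obtain ⟨V, hV⟩ : ∃ V : Fin r → Submodule F (Fin D.rank × Fin n → F),
      ∀ X : Set (Fin r), finrank F ↥(⨆ i ∈ X, V i) = n * D.rho X := by
    obtain ⟨d, V, hV⟩ := h
    let e : (Fin D.rank × Fin n → F) ≃ₗ[F] ↥(⨆ i ∈ Set.univ, V i) :=
      LinearEquiv.ofFinrankEq _ _ (by
        rw [hV Set.univ]
        simp only [Module.finrank_fintype_fun_eq_card, Fintype.card_prod, Fintype.card_fin]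
        exact mul_comm _ _)
    let ψ := (⨆ i ∈ Set.univ, V i).subtype ∘ₗ e.toLinearMap
    have hψ : Function.Injective ψ := Subtype.val_injective.comp e.injective
    have hmap : ∀ i, ((V i).comap ψ).map ψ = V i := fun i => by
      refine map_comap_eq_of_le fun v hv => ?_
      have hv' : v ∈ ⨆ i ∈ Set.univ, V i := mem_iSup_of_mem i (mem_iSup_of_mem trivial hv)
      exact ⟨e.symm ⟨v, hv'⟩, by simp [ψ]⟩
    refine ⟨fun i => (V i).comap ψ, fun X => ?_⟩
    have hX : (⨆ i ∈ X, (V i).comap ψ).map ψ = ⨆ i ∈ X, V i := by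
      simp only [Submodule.map_iSup, hmap]
    exact (equivMapOfInjective ψ hψ _).finrank_eq.trans (by rw [hX, hV X])
  obtain ⟨F', _, _, φ, g, hgV, hg⟩ := exists_finite_extension_generic
    fun q : (Σ i : Fin r, Fin (D.rho {i})) × Fin n => V q.1.1
  have hli : ∀ b, D.IsBasisVec b → ∀ T, (∀ l, D.sliceCard T l = b l) →
      LinearIndepOn F' g (T ×ˢ Set.univ) := by
    intro b hb T hT
    let e : Fin D.rank × Fin n ≃ ↥(T ×ˢ (Set.univ : Set (Fin n))) := Fintype.equivOfCardEq (by
      rw [← Nat.card_eq_fintype_card (α := ↥(T ×ˢ (Set.univ : Set (Fin n)))),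
        Nat.card_coe_set_eq, ncard_prod_univ_eq_finrank (F := F) hb hT, finrank_fintype_fun_eq_card])
    have hinj : Function.Injective fun a => (e a).1 := Subtype.val_injective.comp e.injective
    refine (linearIndependent_equiv e).1 (hg (fun a => (e a).1) hinj ?_)
    refine exists_linearIndependent_mem_of_card_le_finrank _ fun A => ?_
    let X : Set (Fin r) := {i | ∃ a ∈ A, (e a).1.1.1 = i}
    calc A.card = ((fun a => (e a).1) '' (A : Set (Fin D.rank × Fin n))).ncard := by
          rw [Set.ncard_image_of_injective _ hinj, Set.ncard_coe_finset]
      _ ≤ ({t | t ∈ T ∧ t.1 ∈ X} ×ˢ (Set.univ : Set (Fin n))).ncard := by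
          refine Set.ncard_le_ncard ?_ (Set.toFinite _)
          rintro _ ⟨a, ha, rfl⟩
          exact ⟨⟨(e a).2.1, a, ha, rfl⟩, trivial⟩
      _ = n * setSum b X := by
          rw [Set.ncard_prod, D.ncard_sep_eq_setSum_sliceCard, funext hT, Set.ncard_univ,
            Nat.card_eq_fintype_card, Fintype.card_fin, mul_comm]
      _ ≤ n * D.rho X := Nat.mul_le_mul_left _ (setSum_le_rho hb.1 X)
      _ = finrank F ↥(⨆ i ∈ X, V i) := (hV X).symm
      _ ≤ _ := by
          refine finrank_mono (iSup₂_le ?_)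
          rintro _ ⟨a, ha, rfl⟩
          exact le_iSup₂_of_le a ha le_rfl
  refine ⟨F', inferInstance, inferInstance, g, fun b hb T hT => ?_,
    fun c hc j hj p T hT hTj hp s => ?_⟩
  · refine eq_top_of_finrank_eq ?_
    rw [(hli b hb T hT).finrank_span_image_eq_ncard,
      ncard_prod_univ_eq_finrank (F := F') hb hT]
  · have hslice : ∀ l, D.sliceCard T l = (c - Pi.single j 1 : Fin r → ℕ) l := fun l => by
      by_cases hl : l = j
      · subst hl
        simpa using hTj
      · simpa [hl] using hT l hl
    obtain ⟨b, hb, hcb⟩ := exists_isBasisVec_ge (hc.sub_single_mem hj)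
    obtain ⟨T', hTT', hT'⟩ := exists_superset_sliceCard_eq
      (fun l => (hslice l).trans_le (hcb l)) (fun l => le_rho_singleton hb.1 l)
    have hliT : LinearIndepOn F' g (T ×ˢ Set.univ) :=
      (hli b hb T' hT').mono (Set.prod_mono hTT' le_rfl)
    have hmem : ∀ q : (Σ i : Fin r, Fin (D.rho {i})) × Fin n, c q.1.1 ≠ 0 → g q ∈
        span F' ((fun v : Fin D.rank × Fin n → F => φ ∘ v) '' ↑(⨆ i ∈ {i | c i ≠ 0}, V i)) :=
      fun q hq => span_mono (Set.image_mono
        (le_iSup₂_of_le (f := fun i (_ : i ∈ {i | c i ≠ 0}) => V i) q.1.1 hq le_rfl)) (hgV q)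
    have hle : span F' (g '' (T ×ˢ Set.univ)) ≤
        span F' ((fun v : Fin D.rank × Fin n → F => φ ∘ v) '' ↑(⨆ i ∈ {i | c i ≠ 0}, V i)) := by
      refine span_le.2 ?_
      rintro _ ⟨⟨t, s⟩, ⟨ht, -⟩, rfl⟩
      refine hmem _ fun h0 => ?_
      have hpos : 0 < D.sliceCard T t.1 := (Set.ncard_pos (Set.toFinite _)).2 ⟨t.2, ht⟩
      rw [hslice, Pi.sub_apply, h0] at hpos
      omega
    rw [eq_of_le_of_finrank_le hle ?_]
    · exact hmem _ hj
    · refine (finrank_span_image_comp_le φ _).trans ?_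
      rw [hV, hliT.finrank_span_image_eq_ncard, Set.ncard_prod, ncard_eq_sum_sliceCard,
        funext hslice, Set.ncard_univ, Nat.card_eq_fintype_card, Fintype.card_fin, mul_comm]
      have h1 := hc.rho_support_lt
      have h2 := sum_sub_single hj
      exact Nat.mul_le_mul_right _ (by omega)

end DiscretePolymatroid

/-- **Corollary 3.** A perfect linear index coding solution of dimension `n` over some
finite field exists for the index coding problem `I^D(Z,R)` if and only if the discrete
polymatroid `nD` (with rank function `X ↦ n·ρ(X)`) is representable over some finite
field. -/
theorem perfectLinearIndexCode_iff_representable_someField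
    {r : ℕ} (hr : 0 < r) (D : DiscretePolymatroid r) (n : ℕ) (hn : 0 < n) :
    (∃ (F : Type) (instF : Field F) (_ : Fintype F),
        @HasLinearIndexCode _ D.indexProblem F instF n (n * D.indexCodeLen)) ↔
    (∃ (F : Type) (instF : Field F) (_ : Fintype F),
        @RepFnOver r (fun X => n * D.rho X) F instF) := by
  constructor
  · rintro ⟨F, instF, hF, h⟩
    obtain ⟨g, hg⟩ := DiscretePolymatroid.exists_isCodeConfiguration_of_hasLinearIndexCode h
    exact ⟨F, instF, hF, hg.repFnOver⟩
  · rintro ⟨F, instF, hF, h⟩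
    obtain ⟨F', instF', hF', g, hg⟩ :=
      DiscretePolymatroid.exists_isCodeConfiguration_of_repFnOver h
    exact ⟨F', instF', hF', hg.hasLinearIndexCode⟩
end

section
/- Let V_1,...,V_r be subspaces of a finite-dimensional vector space over a field, and let u ∈ ℤ_{≥0}^r with i-th component u_i = 1 for some index i. Suppose that (a) for every A ⊆ {1,...,r}, ∑_{j∈A} (u − ε_i)_j ≤ dim(∑_{j∈A} V_j), where ε_i is the i-th standard unit vector, and (b) there exists A' ⊆ {1,...,r} with dim(∑_{j∈A'} V_j) < ∑_{j∈A'} u_j. Then dim(∑_{j∈supp(u)} V_j) = dim(∑_{j∈supp(u−ε_i)} V_j); equivalently, V_i ⊆ ∑_{j∈supp(u−ε_i)} V_j. -/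
open scoped Classical

/-- The key claim used in the proof that networks constructed from representable discrete
polymatroids are discrete polymatroidal.  Here `Function.update u i 0` is the vector
`u − ε_i` (note `u i = 1`): hypothesis `ha` says `u − ε_i ∈ D(V_1,…,V_r)` and `hb` says
`u ∉ D(V_1,…,V_r)`.  The conclusion is
`dim (∑_{j ∈ supp u} V_j) = dim (∑_{j ∈ supp (u−ε_i)} V_j)`; equivalently
`V_i ⊆ ∑_{j ∈ supp (u−ε_i)} V_j`. -/
theorem dim_supp_eq_of_excluded {r : ℕ}
    (K : Type) [Field K] (W : Type) [AddCommGroup W] [Module K W] [FiniteDimensional K W]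
    (V : Fin r → Submodule K W) (u : Fin r → ℕ) (i : Fin r) (hui : u i = 1)
    (ha : ∀ A : Set (Fin r),
      setSum (Function.update u i 0) A ≤ Module.finrank K ↥(⨆ j ∈ A, V j))
    (hb : ∃ A' : Set (Fin r), Module.finrank K ↥(⨆ j ∈ A', V j) < setSum u A') :
    Module.finrank K ↥(⨆ j ∈ {j : Fin r | u j ≠ 0}, V j) =
      Module.finrank K ↥(⨆ j ∈ {j : Fin r | Function.update u i 0 j ≠ 0}, V j) ∧
    V i ≤ ⨆ j ∈ {j : Fin r | Function.update u i 0 j ≠ 0}, V j := by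
  obtain ⟨A, hA⟩ := hb
  set w := Function.update u i 0
  have hw_ne : ∀ j, j ≠ i → w j = u j := fun j hj => Function.update_of_ne hj _ _
  have hiA : i ∈ A := by
    by_contra hi
    have hsum : setSum w A = setSum u A :=
      Finset.sum_congr rfl fun j hj =>
        hw_ne j (by rintro rfl; exact hi (Finset.mem_filter.1 hj).2)
    have := ha A
    omega
  have hsum : setSum u A = setSum w A + 1 := by
    have hmem : i ∈ Finset.univ.filter (· ∈ A) := by simpa using hiA
    have hwi : w i = 0 := Function.update_self _ _ _
    unfold setSum
    have herase := Finset.sum_congr rfl fun j (hj : j ∈ (Finset.univ.filter (· ∈ A)).erase i) =>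
      hw_ne j (Finset.ne_of_mem_erase hj)
    rw [← Finset.add_sum_erase _ u hmem, ← Finset.add_sum_erase _ w hmem, hui, hwi, herase,
      zero_add, add_comm]
  have hsupp : setSum w (A ∩ {j | w j ≠ 0}) = setSum w A := by
    unfold setSum
    refine Finset.sum_subset (fun j hj => ?_) fun j hj hj' => ?_
    · simp_all
    · by_contra h
      exact hj' (by simp_all)
  have hle : ⨆ j ∈ A ∩ {j | w j ≠ 0}, V j ≤ ⨆ j ∈ A, V j :=
    biSup_mono fun j hj => hj.1
  have heq : ⨆ j ∈ A ∩ {j | w j ≠ 0}, V j = ⨆ j ∈ A, V j := by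
    apply Submodule.eq_of_le_of_finrank_le hle
    have := ha (A ∩ {j | w j ≠ 0})
    omega
  have hVi : V i ≤ ⨆ j ∈ {j | w j ≠ 0}, V j :=
    calc V i ≤ ⨆ j ∈ A, V j := le_biSup V hiA
      _ = ⨆ j ∈ A ∩ {j | w j ≠ 0}, V j := heq.symm
      _ ≤ _ := biSup_mono fun j hj => hj.2
  refine ⟨?_, hVi⟩
  suffices h : ⨆ j ∈ {j | u j ≠ 0}, V j = ⨆ j ∈ {j | w j ≠ 0}, V j by rw [h]
  refine le_antisymm (iSup₂_le fun j hj => ?_) (biSup_mono fun j hj => ?_)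
  · by_cases hji : j = i
    · exact hji ▸ hVi
    · exact le_biSup V (show w j ≠ 0 by rwa [hw_ne j hji])
  · by_cases hji : j = i
    · simp [hji, hui]
    · exact show u j ≠ 0 from hw_ne j hji ▸ hj
end

section
/- The following network admits a scalar linear solution over every finite field F_q with q > 2. Vertices: 1, 2, 3', 3, 4', 4, 5, 6, 7, 8, 9, 10. Node 1 has an input edge generating the message x_1 and node 2 has an input edge generating the message x_2. Edges: 1→3', 2→3', 3'→3, 1→4', 2→4', 4'→4, 1→5, 3→5, 2→6, 3→6, 1→7, 4→7, 2→8, 4→8, 3→9, 4→9, 3→10, 4→10. Demands: node 5 demands x_2, node 6 demands x_1, node 7 demands x_2, node 8 demands x_1, node 9 demands x_1, node 10 demands x_2. -/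
open scoped Classical

structure Network where
  V : Type
  E : Type
  [fintV : Fintype V]
  [fintE : Fintype E]
  hd : E → V
  tl : E → V
  acyclic : ∃ f : V → ℕ, ∀ e : E, f (hd e) < f (tl e)
  demand : V → Set E
  demand_isInput : ∀ v : V, ∀ e ∈ demand v, ∀ e' : E, tl e' ≠ hd e

namespace Network

variable (N : Network)

instance : Fintype N.V := N.fintV
instance : Fintype N.E := N.fintE

/-- An input edge: its head vertex has in-degree zero. -/
def IsInput (e : N.E) : Prop := ∀ e' : N.E, N.tl e' ≠ N.hd e

/-- The set of input edges, as a type. -/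
abbrev InputEdge : Type := {e : N.E // N.IsInput e}

/-- The space of message tuples: input edge `i` generates a row vector of length `k i`. -/
abbrev MsgSpace (F : Type) (k : N.InputEdge → ℕ) : Type :=
  ∀ i : N.InputEdge, Fin (k i) → F

/-- Incoming edges of a vertex. -/
def inSet (v : N.V) : Set N.E := {e | N.tl e = v}

/-- Outgoing intermediate edges of a vertex, together with its demands. -/
def outSet (v : N.V) : Set N.E :=
  {e | N.hd e = v ∧ ¬ N.IsInput e} ∪ N.demand v

/-- A `(k;n)`-fractional network coding solution over `F`.  The value carried by an input
edge is its message (condition (N1) is thus built in); `φ` gives the values carried by the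
intermediate edges; `decode` is condition (N2) and `localEnc` is condition (N3). -/
structure FNCSol (F : Type) [Field F] (k : N.InputEdge → ℕ) (n : ℕ) where
  φ : ∀ e : N.E, ¬ N.IsInput e → N.MsgSpace F k → (Fin n → F)
  decode : ∀ (v : N.V) (j : N.E) (hj : j ∈ N.demand v),
    ∃ χ : ((∀ i : {i : N.InputEdge // N.tl i.1 = v}, Fin (k i.1) → F) ×
           (∀ e : {e : N.E // N.tl e = v ∧ ¬ N.IsInput e}, Fin n → F)) →
          (Fin (k ⟨j, N.demand_isInput v j hj⟩) → F),
      ∀ x : N.MsgSpace F k,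
        χ (fun i => x i.1, fun e => φ e.1 e.2.2 x) = x ⟨j, N.demand_isInput v j hj⟩
  localEnc : ∀ (e : N.E) (he : ¬ N.IsInput e),
    ∃ g : ((∀ i : {i : N.InputEdge // N.tl i.1 = N.hd e}, Fin (k i.1) → F) ×
           (∀ e' : {e' : N.E // N.tl e' = N.hd e ∧ ¬ N.IsInput e'}, Fin n → F)) →
          (Fin n → F),
      ∀ x : N.MsgSpace F k, φ e he x = g (fun i => x i.1, fun e' => φ e'.1 e'.2.2 x)

/-- A solution is linear if all global encoding functions, all decoding functions and all
local encoding functions are `F`-linear. -/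
def FNCSol.IsLinear {N : Network} {F : Type} [Field F] {k : N.InputEdge → ℕ} {n : ℕ}
    (sol : N.FNCSol F k n) : Prop :=
  (∀ (e : N.E) (he : ¬ N.IsInput e), IsLinearMap F (sol.φ e he)) ∧
  (∀ (v : N.V) (j : N.E) (hj : j ∈ N.demand v),
    ∃ χ : ((∀ i : {i : N.InputEdge // N.tl i.1 = v}, Fin (k i.1) → F) ×
           (∀ e : {e : N.E // N.tl e = v ∧ ¬ N.IsInput e}, Fin n → F)) →
          (Fin (k ⟨j, N.demand_isInput v j hj⟩) → F),
      IsLinearMap F χ ∧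
      ∀ x : N.MsgSpace F k,
        χ (fun i => x i.1, fun e => sol.φ e.1 e.2.2 x) = x ⟨j, N.demand_isInput v j hj⟩) ∧
  (∀ (e : N.E) (he : ¬ N.IsInput e),
    ∃ g : ((∀ i : {i : N.InputEdge // N.tl i.1 = N.hd e}, Fin (k i.1) → F) ×
           (∀ e' : {e' : N.E // N.tl e' = N.hd e ∧ ¬ N.IsInput e'}, Fin n → F)) →
          (Fin n → F),
      IsLinearMap F g ∧
      ∀ x : N.MsgSpace F k, sol.φ e he x = g (fun i => x i.1, fun e' => sol.φ e'.1 e'.2.2 x))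

end Network

/-- The network of Fig. 5, constructed from the discrete polymatroid `2D(U_{2,4})`.
Vertices `0,1` are auxiliary sources; `2,3` are the nodes `1,2` receiving the input edges
generating `x_1,x_2`; `4,5,6,7` are `3',3,4',4`; and `8,…,13` are the demanding nodes
`5,…,10`. -/
def paperNet : Network where
  V := Fin 14
  E := Fin 20
  hd := ![0,1,2,3,4,2,3,6,2,5,3,5,2,7,3,7,5,7,5,7]
  tl := ![2,3,4,4,5,6,6,7,8,8,9,9,10,10,11,11,12,12,13,13]
  acyclic := ⟨![0,0,1,1,2,3,2,3,4,4,4,4,4,4], by decide⟩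
  demand := fun v => {e | (v = 8 ∧ e = 1) ∨ (v = 9 ∧ e = 0) ∨ (v = 10 ∧ e = 1) ∨
    (v = 11 ∧ e = 0) ∨ (v = 12 ∧ e = 0) ∨ (v = 13 ∧ e = 1)}
  demand_isInput := by
    intro v e he e'
    rcases he with ⟨_, rfl⟩|⟨_, rfl⟩|⟨_, rfl⟩|⟨_, rfl⟩|⟨_, rfl⟩|⟨_, rfl⟩ <;>
      (revert e'; decide)

namespace Network

/-- A linear combination of the values carried by the edges entering `v` is a linear function of
the inputs and intermediate values seen at `v`. -/
theorem exists_isLinearMap_of_mem_span {N : Network} {F : Type} [Field F]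
    {w : N.E → N.MsgSpace F (fun _ => 1) →ₗ[F] (Fin 1 → F)}
    (hw : ∀ i : N.InputEdge, w i.1 = LinearMap.proj i) {v : N.V}
    {f : N.MsgSpace F (fun _ => 1) →ₗ[F] (Fin 1 → F)}
    (hf : f ∈ Submodule.span F (w '' N.inSet v)) :
    ∃ χ : ((∀ _ : {i : N.InputEdge // N.tl i.1 = v}, Fin 1 → F) ×
           (∀ _ : {e : N.E // N.tl e = v ∧ ¬ N.IsInput e}, Fin 1 → F)) → (Fin 1 → F),
      IsLinearMap F χ ∧
      ∀ x : N.MsgSpace F (fun _ => 1), χ (fun i => x i.1, fun e => w e.1 x) = f x := by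
  induction hf using Submodule.span_induction with
  | mem f hf =>
    obtain ⟨e, he, rfl⟩ := hf
    by_cases hin : N.IsInput e
    · exact ⟨fun p => p.1 ⟨⟨e, hin⟩, he⟩, ⟨fun _ _ => rfl, fun _ _ => rfl⟩,
        fun x => by rw [hw ⟨e, hin⟩]; rfl⟩
    · exact ⟨fun p => p.2 ⟨e, he, hin⟩, ⟨fun _ _ => rfl, fun _ _ => rfl⟩, fun _ => rfl⟩
  | zero => exact ⟨0, (0 : _ →ₗ[F] (Fin 1 → F)).isLinear, fun _ => rfl⟩
  | add f g _ _ hf hg =>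
    obtain ⟨χ, hχ, hχf⟩ := hf
    obtain ⟨ξ, hξ, hξg⟩ := hg
    exact ⟨fun p => χ p + ξ p, (hχ.mk' χ + hξ.mk' ξ).isLinear,
      fun x => congrArg₂ (· + ·) (hχf x) (hξg x)⟩
  | smul a f _ hf =>
    obtain ⟨χ, hχ, hχf⟩ := hf
    exact ⟨fun p => a • χ p, (a • hχ.mk' χ).isLinear, fun x => congrArg (a • ·) (hχf x)⟩

/-- Global encoding functionals satisfying the span conditions at every intermediate edge and
every demand form a scalar linear solution. -/
theorem exists_isLinear_of_mem_span {N : Network} {F : Type} [Field F]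
    (w : N.E → N.MsgSpace F (fun _ => 1) →ₗ[F] (Fin 1 → F))
    (hw : ∀ i : N.InputEdge, w i.1 = LinearMap.proj i)
    (henc : ∀ e, ¬ N.IsInput e → w e ∈ Submodule.span F (w '' N.inSet (N.hd e)))
    (hdec : ∀ v, ∀ j ∈ N.demand v, w j ∈ Submodule.span F (w '' N.inSet v)) :
    ∃ sol : N.FNCSol F (fun _ => 1) 1, sol.IsLinear := by
  have hD := fun (v : N.V) (j : N.E) (hj : j ∈ N.demand v) =>
    exists_isLinearMap_of_mem_span hw (hdec v j hj)
  have hE := fun (e : N.E) (he : ¬ N.IsInput e) =>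
    exists_isLinearMap_of_mem_span hw (henc e he)
  have hproj : ∀ (v : N.V) (j : N.E) (hj : j ∈ N.demand v) (x : N.MsgSpace F (fun _ => 1)),
      w j x = x ⟨j, N.demand_isInput v j hj⟩ :=
    fun v j hj x => by rw [hw ⟨j, N.demand_isInput v j hj⟩]; rfl
  refine ⟨⟨fun e _ => w e, fun v j hj => ?_, fun e he => ?_⟩,
    fun e _ => (w e).isLinear, fun v j hj => ?_, fun e he => ?_⟩
  · obtain ⟨χ, -, hχ⟩ := hD v j hj
    exact ⟨χ, fun x => (hχ x).trans (hproj v j hj x)⟩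
  · obtain ⟨g, -, hg⟩ := hE e he
    exact ⟨g, fun x => (hg x).symm⟩
  · obtain ⟨χ, hlin, hχ⟩ := hD v j hj
    exact ⟨χ, hlin, fun x => (hχ x).trans (hproj v j hj x)⟩
  · obtain ⟨g, hlin, hg⟩ := hE e he
    exact ⟨g, hlin, fun x => (hg x).symm⟩

end Network

theorem paperNet_isInput_iff (e : Fin 20) : paperNet.IsInput e ↔ e = 0 ∨ e = 1 := by
  have h : ∀ e : Fin 20,
      (∀ e' : Fin 20, (![2,3,4,4,5,6,6,7,8,8,9,9,10,10,11,11,12,12,13,13] : Fin 20 → Fin 14) e' ≠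
        (![0,1,2,3,4,2,3,6,2,5,3,5,2,7,3,7,5,7,5,7] : Fin 20 → Fin 14) e) ↔
      e = 0 ∨ e = 1 := by decide
  exact h e

/-- The coefficients of `x₁` and `x₂` on the edges of `paperNet`: node `3` forwards `x₁ + x₂` and
node `4` forwards `x₁ + a x₂`. -/
def paperNetCoeff {F : Type} [Field F] (a : F) : Fin 20 → F × F :=
  ![(1, 0), (0, 1), (1, 0), (0, 1), (1, 1), (1, 0), (0, 1), (1, a), (1, 0), (1, 1),
    (0, 1), (1, 1), (1, 0), (1, a), (0, 1), (1, a), (1, 1), (1, a), (1, 1), (1, a)]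

theorem paperNetCoeff_encode {F : Type} [Field F] (a : F) (e : Fin 20)
    (he : ¬ (e = 0 ∨ e = 1)) :
    ∃ e₁ e₂ : Fin 20, paperNet.tl e₁ = paperNet.hd e ∧ paperNet.tl e₂ = paperNet.hd e ∧
      ∃ b c : F, paperNetCoeff a e = b • paperNetCoeff a e₁ + c • paperNetCoeff a e₂ := by
  have forward : ∀ e₁ : Fin 20, paperNet.tl e₁ = paperNet.hd e →
      paperNetCoeff a e = paperNetCoeff a e₁ →
      ∃ e₁ e₂ : Fin 20, paperNet.tl e₁ = paperNet.hd e ∧ paperNet.tl e₂ = paperNet.hd e ∧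
      ∃ b c : F, paperNetCoeff a e = b • paperNetCoeff a e₁ + c • paperNetCoeff a e₂ :=
    fun e₁ h₁ h => ⟨e₁, e₁, h₁, h₁, 1, 0, by simpa using h⟩
  fin_cases e <;> first
    | exact absurd (by decide) he
    | exact forward 0 rfl rfl
    | exact forward 1 rfl rfl
    | exact forward 4 rfl rfl
    | exact forward 7 rfl rfl
    | exact ⟨2, 3, rfl, rfl, 1, 1, by simp [paperNetCoeff]⟩
    | exact ⟨5, 6, rfl, rfl, 1, a, by simp [paperNetCoeff]⟩

theorem paperNetCoeff_decode {F : Type} [Field F] {a : F} (ha : a ≠ 0) (ha' : a ≠ 1)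
    (v : Fin 14) (j : Fin 20) (hj : j ∈ paperNet.demand v) :
    ∃ e₁ e₂ : Fin 20, paperNet.tl e₁ = v ∧ paperNet.tl e₂ = v ∧
      ∃ b c : F, paperNetCoeff a j = b • paperNetCoeff a e₁ + c • paperNetCoeff a e₂ := by
  have hsub : a - 1 ≠ 0 := sub_ne_zero.mpr ha'
  rcases hj with ⟨rfl, rfl⟩ | ⟨rfl, rfl⟩ | ⟨rfl, rfl⟩ | ⟨rfl, rfl⟩ | ⟨rfl, rfl⟩ | ⟨rfl, rfl⟩
  · exact ⟨8, 9, rfl, rfl, -1, 1, by simp [paperNetCoeff]⟩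
  · exact ⟨10, 11, rfl, rfl, -1, 1, by simp [paperNetCoeff]⟩
  · exact ⟨12, 13, rfl, rfl, -a⁻¹, a⁻¹, by simp [paperNetCoeff, ha]⟩
  · exact ⟨14, 15, rfl, rfl, -a, 1, by simp [paperNetCoeff]⟩
  · exact ⟨16, 17, rfl, rfl, a / (a - 1), -1 / (a - 1), by
      simp [paperNetCoeff]; constructor <;> field_simp <;> ring⟩
  · exact ⟨18, 19, rfl, rfl, -1 / (a - 1), 1 / (a - 1), by
      simp [paperNetCoeff]; constructor <;> field_simp <;> ring⟩

/-- **Lemma 2.** The network constructed from `2D(U_{2,4})` (Fig. 5) admits a scalar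
linear solution over every finite field with more than two elements. -/
theorem paperNet_scalar_linear_solution_of_two_lt_card
    (F : Type) [Field F] [Fintype F] (hF : 2 < Fintype.card F) :
    ∃ sol : paperNet.FNCSol F (fun _ => 1) 1, sol.IsLinear := by
  obtain ⟨a, ha, ha'⟩ : ∃ a : F, a ≠ 0 ∧ a ≠ 1 := by
    obtain ⟨a, ha⟩ := Finset.exists_mem_notMem_of_card_lt_card
      (s := ({0, 1} : Finset F)) (t := Finset.univ) (Finset.card_le_two.trans_lt hF)
    exact ⟨a, by simpa using ha⟩
  let i₀ : paperNet.InputEdge := ⟨(0 : Fin 20), (paperNet_isInput_iff 0).mpr (.inl rfl)⟩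
  let i₁ : paperNet.InputEdge := ⟨(1 : Fin 20), (paperNet_isInput_iff 1).mpr (.inr rfl)⟩
  let w : paperNet.E → paperNet.MsgSpace F (fun _ => 1) →ₗ[F] (Fin 1 → F) := fun e =>
    (paperNetCoeff a e).1 • LinearMap.proj i₀ + (paperNetCoeff a e).2 • LinearMap.proj i₁
  have hspan : ∀ (v : paperNet.V) (e : paperNet.E),
      (∃ e₁ e₂ : Fin 20, paperNet.tl e₁ = v ∧ paperNet.tl e₂ = v ∧ ∃ b c : F,
        paperNetCoeff a e = b • paperNetCoeff a e₁ + c • paperNetCoeff a e₂) →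
      w e ∈ Submodule.span F (w '' paperNet.inSet v) := by
    rintro v e ⟨e₁, e₂, h₁, h₂, b, c, h⟩
    have hw : w e = b • w e₁ + c • w e₂ := by
      simp only [w, h, Prod.fst_add, Prod.snd_add, Prod.smul_fst, Prod.smul_snd, smul_eq_mul]
      module
    rw [hw]
    exact add_mem (Submodule.smul_mem _ _ (Submodule.subset_span ⟨e₁, h₁, rfl⟩))
      (Submodule.smul_mem _ _ (Submodule.subset_span ⟨e₂, h₂, rfl⟩))
  refine Network.exists_isLinear_of_mem_span w ?_
    (fun e he => hspan _ e (paperNetCoeff_encode a e fun h => he ((paperNet_isInput_iff e).mpr h)))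
    (fun v j hj => hspan v j (paperNetCoeff_decode ha ha' v j hj))
  rintro ⟨e, he⟩
  rcases (paperNet_isInput_iff e).mp he with rfl | rfl
  · simp [w, paperNetCoeff, i₀]
  · simp [w, paperNetCoeff, i₁]
end

section
/- For the following network, every (k_1,k_2,k_3;n)-FNC solution over any finite field satisfying 2k_i ≥ n for i = 1, 2, 3 must satisfy 2k_1 = 2k_2 = 2k_3 = n; in particular, there is no achievable rate tuple (k_1/n, k_2/n, k_3/n) strictly greater than (1/2, 1/2, 1/2). Vertices: 1, 2, 3, 4', 4, 5, 6, 7. Node i has an input edge generating the message x_i for i = 1, 2, 3. Edges: 1→4', 2→4', 3→4', 4'→4, 4→5, 3→6, 4→6, 2→7, 4→7. Demands: node 5 demands x_1, node 6 demands x_2, node 7 demands x_3. -/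
open scoped Classical

/-- The network of Fig. 8.  Vertices `0,1,2` are auxiliary sources; `3,4,5` are the nodes
`1,2,3` receiving the input edges generating `x_1,x_2,x_3`; `6,7` are `4',4`; and
`8,9,10` are the demanding nodes `5,6,7`. -/
def fncNet : Network where
  V := Fin 11
  E := Fin 12
  hd := ![0,1,2,3,4,5,6,7,5,7,4,7]
  tl := ![3,4,5,6,6,6,7,8,9,9,10,10]
  acyclic := ⟨![0,0,0,1,1,1,2,3,4,4,4], by decide⟩
  demand := fun v => {e | (v = 8 ∧ e = 0) ∨ (v = 9 ∧ e = 1) ∨ (v = 10 ∧ e = 2)}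
  demand_isInput := by
    intro v e he e'
    rcases he with ⟨_, rfl⟩|⟨_, rfl⟩|⟨_, rfl⟩ <;> (revert e'; decide)

namespace Network.FNCSol

variable {N : Network} {F : Type} [Field F] {k : N.InputEdge → ℕ} {n : ℕ}
  (sol : N.FNCSol F k n) {x y : N.MsgSpace F k}

/-- The value on an intermediate edge is determined by the values on the edges entering its
head vertex. -/
theorem φ_congr {e : N.E} (he : ¬ N.IsInput e)
    (hin : ∀ i : N.InputEdge, N.tl i.1 = N.hd e → x i = y i)
    (hmid : ∀ (e' : N.E) (he' : ¬ N.IsInput e'), N.tl e' = N.hd e →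
      sol.φ e' he' x = sol.φ e' he' y) :
    sol.φ e he x = sol.φ e he y := by
  obtain ⟨g, hg⟩ := sol.localEnc e he
  rw [hg x, hg y]
  congr 2
  · exact funext fun i => hin i.1 i.2
  · exact funext fun e' => hmid e'.1 e'.2.2 e'.2.1

/-- A demanded message is determined by the values on the edges entering the demanding vertex. -/
theorem demand_congr {v : N.V} (j : N.InputEdge) (hj : j.1 ∈ N.demand v)
    (hin : ∀ i : N.InputEdge, N.tl i.1 = v → x i = y i)
    (hmid : ∀ (e' : N.E) (he' : ¬ N.IsInput e'), N.tl e' = v →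
      sol.φ e' he' x = sol.φ e' he' y) :
    x j = y j := by
  obtain ⟨χ, hχ⟩ := sol.decode v j.1 hj
  refine (hχ x).symm.trans (Eq.trans ?_ (hχ y))
  congr 2
  · exact funext fun i => hin i.1 i.2
  · exact funext fun e' => hmid e'.1 e'.2.2 e'.2.1

end Network.FNCSol

/-- If a word of length `n` determines the messages `i` and `j` once all the others are fixed,
then the lengths of these two messages add up to at most `n`. -/
theorem add_length_le_of_determines {ι F : Type*} [Fintype F] [Nontrivial F] {k : ι → ℕ} {n : ℕ}
    {i j : ι} (hij : i ≠ j) (z : (∀ l, Fin (k l) → F) → Fin n → F)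
    (hz : ∀ x y, (∀ l, l ≠ i → l ≠ j → x l = y l) → z x = z y → x i = y i ∧ x j = y j) :
    k i + k j ≤ n := by
  obtain ⟨c⟩ : Nonempty F := inferInstance
  let m : (Fin (k i) → F) × (Fin (k j) → F) → ∀ l, Fin (k l) → F := fun p =>
    Function.update (Function.update (fun _ _ => c) i p.1) j p.2
  have hinj : Function.Injective fun p => z (m p) := by
    intro p q hpq
    have h := hz (m p) (m q) (fun l hi hj => by simp [m, hi, hj]) hpq
    exact Prod.ext (by simpa [m, hij] using h.1) (by simpa [m] using h.2)
  have hcard := Fintype.card_le_of_injective _ hinj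
  simp only [Fintype.card_prod, Fintype.card_fun, Fintype.card_fin, ← pow_add] at hcard
  exact (Nat.pow_le_pow_iff_right Fintype.one_lt_card).1 hcard

namespace fncNet

/-- The vertex an edge leaves. -/
def origin (e : Fin 12) : Fin 11 := fncNet.hd e

/-- The vertex an edge enters. -/
def dest (e : Fin 12) : Fin 11 := fncNet.tl e

theorem isInput_iff (e : Fin 12) : fncNet.IsInput e ↔ e = 0 ∨ e = 1 ∨ e = 2 := by
  change (∀ e' : Fin 12, dest e' ≠ origin e) ↔ _
  revert e
  decide

/-- The edge generating the message `x_1`. -/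
def source₁ : fncNet.InputEdge := ⟨(0 : Fin 12), (isInput_iff _).2 (by decide)⟩

/-- The edge generating the message `x_2`. -/
def source₂ : fncNet.InputEdge := ⟨(1 : Fin 12), (isInput_iff _).2 (by decide)⟩

/-- The edge generating the message `x_3`. -/
def source₃ : fncNet.InputEdge := ⟨(2 : Fin 12), (isInput_iff _).2 (by decide)⟩

theorem eq_source (i : fncNet.InputEdge) : i = source₁ ∨ i = source₂ ∨ i = source₃ := by
  rcases (isInput_iff i.1).1 i.2 with h | h | h
  · exact .inl (Subtype.ext h)
  · exact .inr (.inl (Subtype.ext h))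
  · exact .inr (.inr (Subtype.ext h))

/-- The bottleneck edge, which enters node `4`, is an intermediate edge. -/
theorem not_isInput_bottleneck : ¬ fncNet.IsInput (6 : Fin 12) := by
  rw [isInput_iff]; decide

/-- The vertices entered by an input edge are the three source nodes. -/
theorem dest_source (i : fncNet.InputEdge) : dest i.1 = 3 ∨ dest i.1 = 4 ∨ dest i.1 = 5 := by
  rcases eq_source i with rfl | rfl | rfl
  · exact .inl rfl
  · exact .inr (.inl rfl)
  · exact .inr (.inr rfl)

theorem eq_bottleneck_of_dest {e : Fin 12} (h : dest e = 7) : e = 6 := by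
  revert e
  decide

variable {F : Type} [Field F] {k : fncNet.InputEdge → ℕ} {n : ℕ}
  (sol : fncNet.FNCSol F k n) {x y : fncNet.MsgSpace F k}

/-- An edge leaving node `4` carries a function of the value on the bottleneck edge. -/
theorem φ_congr_of_bottleneck
    (hz : sol.φ (6 : Fin 12) not_isInput_bottleneck x =
      sol.φ (6 : Fin 12) not_isInput_bottleneck y)
    {e : Fin 12} (he : ¬ fncNet.IsInput e) (hd : origin e = 7) :
    sol.φ e he x = sol.φ e he y := by
  refine sol.φ_congr he (fun i hi => ?_) (fun e' he' h => ?_)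
  · have h7 : dest i.1 = 7 := hi.trans hd
    rcases dest_source i with h | h | h <;> exact absurd (h.symm.trans h7) (by decide)
  · obtain rfl := eq_bottleneck_of_dest (h.trans hd)
    exact hz

/-- An edge leaving the node of a single source carries a function of its message. -/
theorem φ_congr_of_source (s : fncNet.InputEdge) (hs : x s = y s) {e : Fin 12}
    (he : ¬ fncNet.IsInput e) (hd : dest s.1 = origin e) :
    sol.φ e he x = sol.φ e he y := by
  have huniq : ∀ e' : Fin 12, dest e' = dest s.1 → e' = s.1 := by
    rcases (isInput_iff s.1).1 s.2 with h | h | h <;> rw [h] <;> decide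
  refine sol.φ_congr he (fun i hi => ?_) (fun e' he' h => ?_)
  · obtain rfl : i = s := Subtype.ext (huniq i.1 (hi.trans hd.symm))
    exact hs
  · exact absurd (huniq e' (h.trans hd.symm) ▸ s.2) he'

/-- The message demanded at a node `v` is determined by the value on the bottleneck edge and the
message of a source `s`, if every edge entering `v` comes from node `4` or from the node of `s`. -/
theorem demand_congr_of_bottleneck
    (hz : sol.φ (6 : Fin 12) not_isInput_bottleneck x =
      sol.φ (6 : Fin 12) not_isInput_bottleneck y)
    {v : Fin 11} (j : fncNet.InputEdge) (hj : j.1 ∈ fncNet.demand v)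
    (hv : ∀ e : Fin 12, dest e = v → origin e = 7 ∨
      ∃ s : fncNet.InputEdge, x s = y s ∧ dest s.1 = origin e) :
    x j = y j := by
  refine sol.demand_congr j hj (fun i hi => ?_) (fun e he h => ?_)
  · rcases hv i.1 hi with h | ⟨s, -, h⟩
    · rcases eq_source i with rfl | rfl | rfl <;>
        exact absurd h (show ¬ ((_ : Fin 11) = 7) by decide)
    · exact absurd h (i.2 s.1)
  · rcases hv e h with h | ⟨s, hs, h⟩
    · exact φ_congr_of_bottleneck sol hz he h
    · exact φ_congr_of_source sol s hs he h

theorem dest_eq_eight {e : Fin 12} (h : dest e = 8) : e = 7 := by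
  revert e
  decide

theorem dest_eq_nine {e : Fin 12} (h : dest e = 9) : e = 8 ∨ e = 9 := by
  revert e
  decide

theorem dest_eq_ten {e : Fin 12} (h : dest e = 10) : e = 10 ∨ e = 11 := by
  revert e
  decide

theorem source₁_congr
    (hz : sol.φ (6 : Fin 12) not_isInput_bottleneck x =
      sol.φ (6 : Fin 12) not_isInput_bottleneck y) :
    x source₁ = y source₁ :=
  demand_congr_of_bottleneck sol hz (v := 8) source₁ (.inl ⟨rfl, rfl⟩) fun e h => by
    obtain rfl := dest_eq_eight h
    exact .inl rfl

theorem source₂_congr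
    (hz : sol.φ (6 : Fin 12) not_isInput_bottleneck x =
      sol.φ (6 : Fin 12) not_isInput_bottleneck y)
    (h₃ : x source₃ = y source₃) : x source₂ = y source₂ :=
  demand_congr_of_bottleneck sol hz (v := 9) source₂ (.inr (.inl ⟨rfl, rfl⟩)) fun e h => by
    obtain rfl | rfl := dest_eq_nine h
    · exact .inr ⟨source₃, h₃, rfl⟩
    · exact .inl rfl

theorem source₃_congr
    (hz : sol.φ (6 : Fin 12) not_isInput_bottleneck x =
      sol.φ (6 : Fin 12) not_isInput_bottleneck y)
    (h₂ : x source₂ = y source₂) : x source₃ = y source₃ :=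
  demand_congr_of_bottleneck sol hz (v := 10) source₃ (.inr (.inr ⟨rfl, rfl⟩)) fun e h => by
    obtain rfl | rfl := dest_eq_ten h
    · exact .inr ⟨source₂, h₂, rfl⟩
    · exact .inl rfl

theorem source₁_ne_source₂ : source₁ ≠ source₂ := fun h =>
  absurd (congrArg Subtype.val h) (show (0 : Fin 12) ≠ 1 by decide)

theorem source₁_ne_source₃ : source₁ ≠ source₃ := fun h =>
  absurd (congrArg Subtype.val h) (show (0 : Fin 12) ≠ 2 by decide)

theorem source₂_ne_source₃ : source₂ ≠ source₃ := fun h =>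
  absurd (congrArg Subtype.val h) (show (1 : Fin 12) ≠ 2 by decide)

end fncNet

/-- **Lemma 4(2).** For the network of Fig. 8, every `(k_1,k_2,k_3;n)`-FNC solution with
`k_i/n ≥ 1/2` for all `i` satisfies `k_i/n = 1/2` for all `i`; in particular no achievable
rate tuple is strictly greater than `(1/2,1/2,1/2)`. -/
theorem fncNet_rate_bound
    (F : Type) [Field F] [Fintype F] (k : fncNet.InputEdge → ℕ) (n : ℕ)
    (hsol : Nonempty (fncNet.FNCSol F k n)) (hhalf : ∀ i : fncNet.InputEdge, n ≤ 2 * k i) :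
    ∀ i : fncNet.InputEdge, 2 * k i = n := by
  obtain ⟨sol⟩ := hsol
  have h₁₂ : k fncNet.source₁ + k fncNet.source₂ ≤ n :=
    add_length_le_of_determines fncNet.source₁_ne_source₂ (sol.φ _ fncNet.not_isInput_bottleneck)
      fun x y h hz => ⟨fncNet.source₁_congr sol hz, fncNet.source₂_congr sol hz
        (h _ fncNet.source₁_ne_source₃.symm fncNet.source₂_ne_source₃.symm)⟩
  have h₁₃ : k fncNet.source₁ + k fncNet.source₃ ≤ n :=
    add_length_le_of_determines fncNet.source₁_ne_source₃ (sol.φ _ fncNet.not_isInput_bottleneck)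
      fun x y h hz => ⟨fncNet.source₁_congr sol hz, fncNet.source₃_congr sol hz
        (h _ fncNet.source₁_ne_source₂.symm fncNet.source₂_ne_source₃)⟩
  have := hhalf fncNet.source₁
  have := hhalf fncNet.source₂
  have := hhalf fncNet.source₃
  intro i
  rcases fncNet.eq_source i with rfl | rfl | rfl <;> omega
end
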